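/- arXiv:2504.04659 — 5 statements merged into one kernel-verified Lean document; each statement's English description precedes it below -/
import Mathlib

section
/- Let H_1 be a search-cost distribution on [0, c̄₁] satisfying Assumption 1, let α ∈ (1, μ/c̄₁), and let H_2 on [0, α·c̄₁] be the α-scale stretch of H_1, i.e. H_2(c) := H_1(c/α). Then H_2 satisfies Assumption 1 (with respect to its support [0, α·c̄₁]), s*(H_2) = s*(H_1)/α < s*(H_1), and a^M(H_2) ≤ a^M(H_1); moreover, if a^M(H_1) > 0 then a^M(H_2) < a^M(H_1). -/
open MeasureTheory Set Function Filter

noncomputable section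

namespace CompSearch

def mean (F : ℝ → ℝ) : ℝ := ∫ t in (0:ℝ)..1, (1 - F t)

def cInt (G : ℝ → ℝ) (x : ℝ) : ℝ := ∫ t in x..(1:ℝ), (1 - G t)

/-- The prior F with density f. -/
structure IsPrior (F f : ℝ → ℝ) : Prop where
  zero : ∀ x ≤ (0:ℝ), F x = 0
  one : ∀ x ≥ (1:ℝ), F x = 1
  smooth : ContDiffOn ℝ 2 F (Icc 0 1)
  deriv : ∀ x ∈ Icc (0:ℝ) 1, HasDerivWithinAt F (f x) (Icc 0 1) x
  fpos : ∀ x ∈ Icc (0:ℝ) 1, 0 < f x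
  fcont : ContinuousOn f (Icc 0 1)

/-- A search-cost distribution given as a plain c.d.f. H with density h on [0, c̄]. -/
structure IsCostD (H h : ℝ → ℝ) (cbar : ℝ) : Prop where
  cbar_pos : 0 < cbar
  zero : H 0 = 0
  one : H cbar = 1
  smooth : ContDiffOn ℝ 2 H (Icc 0 cbar)
  deriv : ∀ c ∈ Icc (0:ℝ) cbar, HasDerivWithinAt H (h c) (Icc 0 cbar) c
  hpos : ∀ c ∈ Icc (0:ℝ) cbar, 0 < h c

/-- Average density S(c) = H(c)/c, S(0) = h(0). -/
def Sfun (H h : ℝ → ℝ) (c : ℝ) : ℝ := if c = 0 then h 0 else H c / c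

/-- minimal average density s*(H) = min_{c ∈ [0,c̄]} S(c). -/
def sStar (H h : ℝ → ℝ) (cbar : ℝ) : ℝ := sInf (Sfun H h '' Icc 0 cbar)

/-- Assumption 1: the global minimum of S on [0,c̄] is attained at some c^M < c̄. -/
def Assumption1 (H h : ℝ → ℝ) (cbar : ℝ) : Prop :=
  ∃ cM ∈ Ico (0:ℝ) cbar, ∀ c ∈ Icc (0:ℝ) cbar, Sfun H h cM ≤ Sfun H h c

/-- Inverse of c_F on [0,1]. -/
def cFinv (F : ℝ → ℝ) (y : ℝ) : ℝ := Function.invFunOn (cInt F) (Icc 0 1) y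

/-- The maximally informative threshold a^M(H). -/
def aM (F H h : ℝ → ℝ) (cbar : ℝ) : ℝ :=
  if sStar H h cbar ≤ 1 / mean F then 0 else cFinv F (1 / sStar H h cbar)

/-- H₂ is a mean-preserving spread of H₁ on [0, c̄]. -/
def MPSpread (H1 H2 : ℝ → ℝ) (cbar : ℝ) : Prop :=
  (∀ x ∈ Icc (0:ℝ) cbar, (∫ t in (0:ℝ)..x, H1 t) ≤ ∫ t in (0:ℝ)..x, H2 t) ∧
  (∫ t in (0:ℝ)..cbar, H1 t) = ∫ t in (0:ℝ)..cbar, H2 t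

/-- The density has at most finitely many local extrema: there is a finite
partition of [0,c̄] on each piece of which it is monotone. -/
def FinitelyPiecewiseMono (h : ℝ → ℝ) (cbar : ℝ) : Prop :=
  ∃ (K : ℕ) (x : ℕ → ℝ), 0 < K ∧ x 0 = 0 ∧ x K = cbar ∧
    (∀ i < K, x i ≤ x (i + 1)) ∧
    ∀ i < K, MonotoneOn h (Icc (x i) (x (i + 1))) ∨ AntitoneOn h (Icc (x i) (x (i + 1)))


theorem IsPrior.continuousOn {F f : ℝ → ℝ} (hF : IsPrior F f) : ContinuousOn F (Icc 0 1) :=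
  hF.smooth.continuousOn

theorem IsPrior.le_one {F f : ℝ → ℝ} (hF : IsPrior F f) {x : ℝ} (hx : x ∈ Icc (0:ℝ) 1) :
    F x ≤ 1 := by
  have hmono : MonotoneOn F (Icc 0 1) := by
    refine monotoneOn_of_hasDerivWithinAt_nonneg (f' := f) (convex_Icc 0 1) hF.continuousOn ?_ ?_
    · exact fun y hy => (hF.deriv y (interior_subset hy)).mono interior_subset
    · exact fun y hy => (hF.fpos y (interior_subset hy)).le
  simpa [hF.one 1 le_rfl] using hmono hx (right_mem_Icc.2 zero_le_one) hx.2

theorem IsPrior.intervalIntegrable {F f : ℝ → ℝ} (hF : IsPrior F f) {x y : ℝ}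
    (hx : x ∈ Icc (0:ℝ) 1) (hy : y ∈ Icc (0:ℝ) 1) :
    IntervalIntegrable (fun t => 1 - F t) volume x y :=
  ((continuousOn_const.sub hF.continuousOn).mono
    (uIcc_subset_Icc hx hy)).intervalIntegrable

theorem IsPrior.antitoneOn_cInt {F f : ℝ → ℝ} (hF : IsPrior F f) :
    AntitoneOn (cInt F) (Icc 0 1) := by
  intro x hx y hy hxy
  have h1 : (1:ℝ) ∈ Icc (0:ℝ) 1 := right_mem_Icc.2 zero_le_one
  have hadd := intervalIntegral.integral_add_adjacent_intervals
    (hF.intervalIntegrable hx hy) (hF.intervalIntegrable hy h1)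
  have hnn : 0 ≤ ∫ t in x..y, (1 - F t) :=
    intervalIntegral.integral_nonneg hxy fun t ht =>
      sub_nonneg.2 (hF.le_one ⟨hx.1.trans ht.1, ht.2.trans hy.2⟩)
  simp only [cInt]
  linarith

theorem IsPrior.continuousOn_cInt {F f : ℝ → ℝ} (hF : IsPrior F f) :
    ContinuousOn (cInt F) (Icc 0 1) := by
  have hint : IntegrableOn (fun t => 1 - F t) (uIcc 0 1) := by
    rw [uIcc_of_le zero_le_one]
    exact (continuousOn_const.sub hF.continuousOn).integrableOn_Icc
  have hcont := intervalIntegral.continuousOn_primitive_interval_left hint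
  rwa [uIcc_of_le zero_le_one] at hcont

theorem IsPrior.exists_cInt_eq {F f : ℝ → ℝ} (hF : IsPrior F f) {y : ℝ}
    (hy : y ∈ Icc 0 (mean F)) : ∃ x ∈ Icc (0:ℝ) 1, cInt F x = y := by
  refine intermediate_value_Icc' zero_le_one hF.continuousOn_cInt ?_
  simpa [cInt, mean] using hy

theorem IsPrior.cFinv_mem {F f : ℝ → ℝ} (hF : IsPrior F f) {y : ℝ}
    (hy : y ∈ Icc 0 (mean F)) : cFinv F y ∈ Icc (0:ℝ) 1 :=
  Function.invFunOn_mem (hF.exists_cInt_eq hy)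

theorem IsPrior.cInt_cFinv {F f : ℝ → ℝ} (hF : IsPrior F f) {y : ℝ}
    (hy : y ∈ Icc 0 (mean F)) : cInt F (cFinv F y) = y :=
  Function.invFunOn_eq (hF.exists_cInt_eq hy)

theorem IsPrior.cFinv_strictAntiOn {F f : ℝ → ℝ} (hF : IsPrior F f) :
    StrictAntiOn (cFinv F) (Icc 0 (mean F)) := by
  intro y hy z hz hyz
  by_contra! hle
  have := hF.antitoneOn_cInt (hF.cFinv_mem hy) (hF.cFinv_mem hz) hle
  rw [hF.cInt_cFinv hy, hF.cInt_cFinv hz] at this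
  exact this.not_gt hyz

theorem IsCostD.Sfun_pos {H h : ℝ → ℝ} {cbar : ℝ} (hH : IsCostD H h cbar) {c : ℝ}
    (hc : c ∈ Icc 0 cbar) : 0 < Sfun H h c := by
  have h0 : (0:ℝ) ∈ Icc 0 cbar := left_mem_Icc.2 hH.cbar_pos.le
  have hmono : StrictMonoOn H (Icc 0 cbar) := by
    refine strictMonoOn_of_hasDerivWithinAt_pos (f' := h) (convex_Icc 0 cbar)
      hH.smooth.continuousOn ?_ ?_
    · exact fun y hy => (hH.deriv y (interior_subset hy)).mono interior_subset
    · exact fun y hy => hH.hpos y (interior_subset hy)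
  unfold Sfun
  split_ifs with hc0
  · exact hH.hpos 0 h0
  · have hpos : 0 < c := lt_of_le_of_ne hc.1 (Ne.symm hc0)
    have := hmono h0 hc hpos
    rw [hH.zero] at this
    exact div_pos this hpos

theorem sStar_eq_of_forall_le {H h : ℝ → ℝ} {cbar c : ℝ} (hc : c ∈ Icc 0 cbar)
    (hmin : ∀ x ∈ Icc 0 cbar, Sfun H h c ≤ Sfun H h x) : sStar H h cbar = Sfun H h c :=
  IsLeast.csInf_eq ⟨mem_image_of_mem _ hc, forall_mem_image.2 hmin⟩

theorem Sfun_scale {H1 h1 H2 h2 : ℝ → ℝ} {α : ℝ} (hα : α ≠ 0)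
    (hH2 : ∀ c, H2 c = H1 (c / α)) (hh2 : ∀ c, h2 c = h1 (c / α) / α) (c : ℝ) :
    Sfun H2 h2 c = Sfun H1 h1 (c / α) / α := by
  by_cases hc : c = 0
  · simp [Sfun, hc, hh2]
  · simp only [Sfun, hc, hH2, div_eq_zero_iff, hα, or_self, if_false]
    field_simp

/-- The threshold as a function of the minimal average density `s` is monotone, and strictly so
at points where it is positive. -/
theorem IsPrior.threshold_lt {F f : ℝ → ℝ} (hF : IsPrior F f) (hμ : 0 < mean F) {s t : ℝ}
    (hst : s < t) :
    (if s ≤ 1 / mean F then 0 else cFinv F (1 / s)) ≤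
        (if t ≤ 1 / mean F then 0 else cFinv F (1 / t)) ∧
      (0 < (if t ≤ 1 / mean F then 0 else cFinv F (1 / t)) →
        (if s ≤ 1 / mean F then 0 else cFinv F (1 / s)) <
          (if t ≤ 1 / mean F then 0 else cFinv F (1 / t))) := by
  have hmem : ∀ {u : ℝ}, 1 / mean F < u → 1 / u ∈ Icc 0 (mean F) := fun {u} hu => by
    have hu0 : 0 < u := (one_div_pos.2 hμ).trans hu
    exact ⟨(one_div_pos.2 hu0).le, ((one_div_lt hμ hu0).1 hu).le⟩
  by_cases hs : s ≤ 1 / mean F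
  · rw [if_pos hs]
    refine ⟨?_, id⟩
    split_ifs with ht
    · exact le_rfl
    · exact (hF.cFinv_mem (hmem (not_le.1 ht))).1
  · have hs' := not_le.1 hs
    have ht' := hs'.trans hst
    rw [if_neg hs, if_neg ht'.not_ge]
    have hlt := hF.cFinv_strictAntiOn (hmem ht') (hmem hs')
      (one_div_lt_one_div_of_lt ((one_div_pos.2 hμ).trans hs') hst)
    exact ⟨hlt.le, fun _ => hlt⟩

/-- If H₂(c) = H₁(c/α) is the α-scale stretch of H₁ (which satisfies
Assumption 1), with 1 < α < μ/c̄₁, then H₂ satisfies Assumption 1 on [0, α·c̄₁],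
s*(H₂) = s*(H₁)/α < s*(H₁), and a^M(H₂) ≤ a^M(H₁), strictly if a^M(H₁) > 0. -/
theorem scale_stretch_decreases_informativeness
    (F f : ℝ → ℝ) (hF : IsPrior F f)
    (H1 h1 : ℝ → ℝ) (cbar1 : ℝ) (hH1 : IsCostD H1 h1 cbar1)
    (hcbar1 : cbar1 < mean F)
    (hA1 : Assumption1 H1 h1 cbar1)
    (α : ℝ) (hα1 : 1 < α) (hα2 : α < mean F / cbar1)
    (H2 h2 : ℝ → ℝ)
    (hH2def : ∀ c : ℝ, H2 c = H1 (c / α))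
    (hh2def : ∀ c : ℝ, h2 c = h1 (c / α) / α) :
    Assumption1 H2 h2 (α * cbar1) ∧
    sStar H2 h2 (α * cbar1) = sStar H1 h1 cbar1 / α ∧
    sStar H2 h2 (α * cbar1) < sStar H1 h1 cbar1 ∧
    aM F H2 h2 (α * cbar1) ≤ aM F H1 h1 cbar1 ∧
    (0 < aM F H1 h1 cbar1 → aM F H2 h2 (α * cbar1) < aM F H1 h1 cbar1) := by
  have hα0 : 0 < α := zero_lt_one.trans hα1
  obtain ⟨cM, hcM, hmin⟩ := hA1
  have hS := Sfun_scale hα0.ne' hH2def hh2def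
  have hcM2 : α * cM ∈ Ico 0 (α * cbar1) :=
    ⟨mul_nonneg hα0.le hcM.1, mul_lt_mul_of_pos_left hcM.2 hα0⟩
  have hmin2 : ∀ c ∈ Icc 0 (α * cbar1), Sfun H2 h2 (α * cM) ≤ Sfun H2 h2 c := by
    intro c hc
    rw [hS, hS, mul_div_cancel_left₀ _ hα0.ne']
    have hc' : c / α ∈ Icc 0 cbar1 := ⟨div_nonneg hc.1 hα0.le, (div_le_iff₀' hα0).2 hc.2⟩
    exact div_le_div_of_nonneg_right (hmin _ hc') hα0.le
  have hs1 := sStar_eq_of_forall_le (Ico_subset_Icc_self hcM) hmin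
  have hs2 : sStar H2 h2 (α * cbar1) = sStar H1 h1 cbar1 / α := by
    rw [sStar_eq_of_forall_le (Ico_subset_Icc_self hcM2) hmin2, hs1, hS,
      mul_div_cancel_left₀ _ hα0.ne']
  have hlt : sStar H2 h2 (α * cbar1) < sStar H1 h1 cbar1 := by
    rw [hs2]
    exact div_lt_self (hs1 ▸ hH1.Sfun_pos (Ico_subset_Icc_self hcM)) hα1
  exact ⟨⟨_, hcM2, hmin2⟩, hs2, hlt, hF.threshold_lt (hH1.cbar_pos.trans hcbar1) hlt⟩

end CompSearch
end
end

section
/- Let H_1 and H_2 be search-cost distributions on [0, c̄], each satisfying Assumption 1, whose densities are strictly quasi-concave with interior peaks: for each k there is p_k ∈ (0, c̄) such that h_k is strictly increasing on [0, p_k] and strictly decreasing on [p_k, c̄]. Suppose H_2 is a mean-preserving spread of H_1, i.e. ∫_0^x H_2(t) dt ≥ ∫_0^x H_1(t) dt for all x ∈ [0, c̄] with equality at x = c̄. Then s*(H_k) = h_k(0) for k = 1,2, h_1(0) ≤ h_2(0), and a^M(H_1) ≤ a^M(H_2). -/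
open MeasureTheory Set Function Filter

noncomputable section

namespace CompSearch

theorem exists_slope_eq_of_hasDerivWithinAt_Icc {g g' : ℝ → ℝ} {l u a b : ℝ}
    (hg : ∀ x ∈ Icc l u, HasDerivWithinAt g (g' x) (Icc l u) x)
    (hla : l ≤ a) (hab : a < b) (hbu : b ≤ u) :
    ∃ x ∈ Ioo a b, g b - g a = g' x * (b - a) := by
  have hsub : Icc a b ⊆ Icc l u := Icc_subset_Icc hla hbu
  obtain ⟨x, hx, hslope⟩ := exists_hasDerivAt_eq_slope g g' hab
    (fun x hx => ((hg x (hsub hx)).continuousWithinAt).mono hsub)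
    (fun x hx => (hg x (hsub (Ioo_subset_Icc_self hx))).hasDerivAt
      (Icc_mem_nhds (hla.trans_lt hx.1) (hx.2.trans_le hbu)))
  refine ⟨x, hx, ?_⟩
  rw [hslope, div_mul_cancel₀ _ (sub_pos.2 hab).ne']

theorem IsCostD.continuousOn {H h : ℝ → ℝ} {cbar : ℝ} (hH : IsCostD H h cbar) :
    ContinuousOn H (Icc 0 cbar) :=
  hH.smooth.continuousOn

/-- For a unimodal density, an interior minimizer of the average density lies on the increasing
branch, so the minimal average density is attained at `0`. -/
theorem density_zero_le_Sfun {H h : ℝ → ℝ} {cbar : ℝ} (hH : IsCostD H h cbar)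
    (hA : Assumption1 H h cbar)
    (hqc : ∃ p ∈ Ioo (0:ℝ) cbar, StrictMonoOn h (Icc 0 p) ∧ StrictAntiOn h (Icc p cbar))
    {c : ℝ} (hc : c ∈ Icc (0:ℝ) cbar) : h 0 ≤ Sfun H h c := by
  obtain ⟨m, ⟨hm0, hmc⟩, hmin⟩ := hA
  obtain ⟨p, ⟨hp0, hpc⟩, hmono, hanti⟩ := hqc
  refine le_trans ?_ (hmin c hc)
  rcases hm0.eq_or_lt with rfl | hm0
  · simp [Sfun]
  have hSm : Sfun H h m = H m / m := if_neg hm0.ne'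
  rcases le_or_gt m p with hmp | hpm
  · obtain ⟨x, hx, hslope⟩ := exists_slope_eq_of_hasDerivWithinAt_Icc hH.deriv le_rfl hm0 hmc.le
    rw [hSm, le_div_iff₀ hm0]
    have hle : h 0 ≤ h x := hmono.monotoneOn ⟨le_rfl, hp0.le⟩
      ⟨hx.1.le, hx.2.le.trans hmp⟩ hx.1.le
    rw [hH.zero, sub_zero, sub_zero] at hslope
    rw [hslope]
    exact mul_le_mul_of_nonneg_right hle hm0.le
  · exfalso
    have hline : ∀ x ∈ Ioc (0:ℝ) cbar, H m / m * x ≤ H x := by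
      intro x hx
      have h1 := hmin x ⟨hx.1.le, hx.2⟩
      rw [hSm, Sfun, if_neg hx.1.ne', le_div_iff₀ hx.1] at h1
      exact h1
    have hloc : IsLocalMin (fun x => H x - H m / m * x) m := by
      filter_upwards [Ioo_mem_nhds hm0 hmc] with x hx
      rw [div_mul_cancel₀ _ hm0.ne']
      have := hline x ⟨hx.1, hx.2.le⟩
      linarith
    have hder : HasDerivAt (fun x => H x - H m / m * x) (h m - H m / m * 1) m :=
      ((hH.deriv m ⟨hm0.le, hmc.le⟩).hasDerivAt (Icc_mem_nhds hm0 hmc)).sub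
        ((hasDerivAt_id m).const_mul _)
    have hcrit := hloc.hasDerivAt_eq_zero hder
    obtain ⟨x, hx, hslope⟩ :=
      exists_slope_eq_of_hasDerivWithinAt_Icc hH.deriv hm0.le hmc le_rfl
    have hlt : h x < h m := hanti ⟨hpm.le, hmc.le⟩ ⟨hpm.le.trans hx.1.le, hx.2.le⟩ hx.1
    have hend := hline cbar ⟨hH.cbar_pos, le_rfl⟩
    have hm : H m = h m * m := by
      rw [show h m = H m / m by linarith, div_mul_cancel₀ _ hm0.ne']
    rw [show H m / m = h m by linarith] at hend
    nlinarith [mul_lt_mul_of_pos_right hlt (sub_pos.2 hmc)]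

theorem sStar_eq_density_zero {H h : ℝ → ℝ} {cbar : ℝ} (hH : IsCostD H h cbar)
    (hA : Assumption1 H h cbar)
    (hqc : ∃ p ∈ Ioo (0:ℝ) cbar, StrictMonoOn h (Icc 0 p) ∧ StrictAntiOn h (Icc p cbar)) :
    sStar H h cbar = h 0 := by
  refine IsLeast.csInf_eq ⟨⟨0, ⟨le_rfl, hH.cbar_pos.le⟩, by simp [Sfun]⟩, ?_⟩
  rintro _ ⟨c, hc, rfl⟩
  exact density_zero_le_Sfun hH hA hqc hc

theorem density_zero_le_of_MPSpread {H1 h1 H2 h2 : ℝ → ℝ} {cbar : ℝ}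
    (hH1 : IsCostD H1 h1 cbar) (hH2 : IsCostD H2 h2 cbar) (hmps : MPSpread H1 H2 cbar) :
    h1 0 ≤ h2 0 := by
  by_contra! hlt
  have h0 : (0:ℝ) ∈ Icc 0 cbar := ⟨le_rfl, hH1.cbar_pos.le⟩
  have hder := hasDerivWithinAt_iff_tendsto_slope.1 ((hH1.deriv 0 h0).sub (hH2.deriv 0 h0))
  have hev := hder.eventually (lt_mem_nhds (sub_pos.2 hlt))
  obtain ⟨ε, hε, hball⟩ := Metric.mem_nhdsWithin_iff.1 hev
  set x := min (ε / 2) cbar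
  have hx0 : 0 < x := lt_min (half_pos hε) hH1.cbar_pos
  have hxc : x ≤ cbar := min_le_right _ _
  have hxε : x < ε := (min_le_left _ _).trans_lt (half_lt_self hε)
  have hpos : ∀ t ∈ Ioo 0 x, 0 < H1 t - H2 t := by
    intro t ht
    have hdist : dist t 0 < ε := by
      rw [Real.dist_eq, sub_zero, abs_of_pos ht.1]
      exact ht.2.trans hxε
    have hs : 0 < slope (H1 - H2) 0 t :=
      hball ⟨hdist, ⟨ht.1.le, ht.2.le.trans hxc⟩, ht.1.ne'⟩
    rw [slope_def_field] at hs
    simp only [Pi.sub_apply, hH1.zero, hH2.zero, sub_zero] at hs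
    exact (div_pos_iff_of_pos_right ht.1).1 hs
  have hsub : uIcc 0 x ⊆ Icc 0 cbar := by
    rw [uIcc_of_le hx0.le]
    exact Icc_subset_Icc_right hxc
  have hi1 : IntervalIntegrable H1 volume 0 x := (hH1.continuousOn.mono hsub).intervalIntegrable
  have hi2 : IntervalIntegrable H2 volume 0 x := (hH2.continuousOn.mono hsub).intervalIntegrable
  have hint := intervalIntegral.intervalIntegral_pos_of_pos_on (hi1.sub hi2) hpos hx0
  rw [intervalIntegral.integral_sub hi1 hi2] at hint
  linarith [hmps.1 x ⟨hx0.le, hxc⟩]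

theorem IsPrior.continuousOn_survival {F f : ℝ → ℝ} (hF : IsPrior F f) :
    ContinuousOn (fun t => 1 - F t) (Icc 0 1) :=
  continuousOn_const.sub hF.smooth.continuousOn

theorem IsPrior.intervalIntegrable_survival {F f : ℝ → ℝ} (hF : IsPrior F f) {a b : ℝ}
    (ha : a ∈ Icc (0:ℝ) 1) (hb : b ∈ Icc (0:ℝ) 1) :
    IntervalIntegrable (fun t => 1 - F t) volume a b :=
  (hF.continuousOn_survival.mono (uIcc_subset_Icc ha hb)).intervalIntegrable

theorem IsPrior.lt_one {F f : ℝ → ℝ} (hF : IsPrior F f) {x : ℝ} (h0 : 0 ≤ x) (h1 : x < 1) :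
    F x < 1 := by
  obtain ⟨y, hy, hslope⟩ := exists_slope_eq_of_hasDerivWithinAt_Icc hF.deriv h0 h1 le_rfl
  have hpos := mul_pos (hF.fpos y ⟨h0.trans hy.1.le, hy.2.le⟩) (sub_pos.2 h1)
  rw [hF.one 1 le_rfl] at hslope
  linarith

theorem IsPrior.strictAntiOn_cInt {F f : ℝ → ℝ} (hF : IsPrior F f) :
    StrictAntiOn (cInt F) (Icc 0 1) := by
  intro a ha b hb hab
  have hone : (1:ℝ) ∈ Icc (0:ℝ) 1 := ⟨zero_le_one, le_rfl⟩
  have hpos := intervalIntegral.intervalIntegral_pos_of_pos_on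
    (hF.intervalIntegrable_survival ha hb)
    (fun t ht => sub_pos.2 (hF.lt_one (ha.1.trans ht.1.le) (ht.2.trans_le hb.2))) hab
  have hadd := intervalIntegral.integral_add_adjacent_intervals
    (hF.intervalIntegrable_survival ha hb) (hF.intervalIntegrable_survival hb hone)
  simp only [cInt]
  linarith

theorem IsPrior.Icc_subset_image_cInt {F f : ℝ → ℝ} (hF : IsPrior F f) :
    Icc 0 (mean F) ⊆ cInt F '' Icc 0 1 := by
  have hint : IntegrableOn (fun t => 1 - F t) (uIcc 0 1) := by
    rw [uIcc_of_le zero_le_one]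
    exact hF.continuousOn_survival.integrableOn_Icc
  have hcont : ContinuousOn (cInt F) (Icc 0 1) := by
    have h := intervalIntegral.continuousOn_primitive_interval_left hint
    rwa [uIcc_of_le zero_le_one] at h
  have hivt := intermediate_value_Icc' zero_le_one hcont
  rwa [show cInt F 1 = 0 from intervalIntegral.integral_same] at hivt

theorem IsPrior.antitoneOn_cFinv {F f : ℝ → ℝ} (hF : IsPrior F f) :
    AntitoneOn (cFinv F) (Icc 0 (mean F)) := by
  intro y hy z hz hyz
  refine (hF.strictAntiOn_cInt.le_iff_ge (hF.cFinv_mem hy) (hF.cFinv_mem hz)).1 ?_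
  have hy' : cInt F (cFinv F y) = y := Function.invFunOn_eq (hF.Icc_subset_image_cInt hy)
  have hz' : cInt F (cFinv F z) = z := Function.invFunOn_eq (hF.Icc_subset_image_cInt hz)
  rwa [hy', hz']

theorem aM_le_aM_of_sStar_le {F f H1 h1 H2 h2 : ℝ → ℝ} {cbar : ℝ} (hF : IsPrior F f)
    (hmean : 0 < mean F) (hs : sStar H1 h1 cbar ≤ sStar H2 h2 cbar) :
    aM F H1 h1 cbar ≤ aM F H2 h2 cbar := by
  have hmem : ∀ {s : ℝ}, 1 / mean F < s → 1 / s ∈ Icc 0 (mean F) := by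
    intro s h
    have hs0 : 0 < s := (one_div_pos.2 hmean).trans h
    exact ⟨(one_div_pos.2 hs0).le, ((one_div_lt hs0 hmean).2 h).le⟩
  unfold aM
  split_ifs with c1 c2 c2
  · exact le_rfl
  · exact (hF.cFinv_mem (hmem (not_le.1 c2))).1
  · exact absurd (hs.trans c2) c1
  · rw [not_le] at c1 c2
    exact hF.antitoneOn_cFinv (hmem c2) (hmem c1)
      (one_div_le_one_div_of_le ((one_div_pos.2 hmean).trans c1) hs)

/-- If H₁, H₂ satisfy Assumption 1, both have strictly quasi-concave densities
with interior peaks, and H₂ is a mean-preserving spread of H₁, then s*(H_k) = h_k(0),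
h₁(0) ≤ h₂(0), and a^M(H₁) ≤ a^M(H₂). -/
theorem mps_quasiconcave_increases_informativeness
    (F f : ℝ → ℝ) (hF : IsPrior F f)
    (H1 h1 H2 h2 : ℝ → ℝ) (cbar : ℝ)
    (hH1 : IsCostD H1 h1 cbar) (hH2 : IsCostD H2 h2 cbar)
    (hcbar : cbar < mean F)
    (hA1 : Assumption1 H1 h1 cbar) (hA2 : Assumption1 H2 h2 cbar)
    (hqc1 : ∃ p ∈ Ioo (0:ℝ) cbar, StrictMonoOn h1 (Icc 0 p) ∧ StrictAntiOn h1 (Icc p cbar))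
    (hqc2 : ∃ p ∈ Ioo (0:ℝ) cbar, StrictMonoOn h2 (Icc 0 p) ∧ StrictAntiOn h2 (Icc p cbar))
    (hmps : MPSpread H1 H2 cbar) :
    sStar H1 h1 cbar = h1 0 ∧ sStar H2 h2 cbar = h2 0 ∧
    h1 0 ≤ h2 0 ∧
    aM F H1 h1 cbar ≤ aM F H2 h2 cbar := by
  have hs1 := sStar_eq_density_zero hH1 hA1 hqc1
  have hs2 := sStar_eq_density_zero hH2 hA2 hqc2
  have hle := density_zero_le_of_MPSpread hH1 hH2 hmps
  exact ⟨hs1, hs2, hle,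
    aM_le_aM_of_sStar_le hF (hH1.cbar_pos.trans hcbar) (by rwa [hs1, hs2])⟩

end CompSearch
end
end

section
/- Let F be a twice continuously differentiable cumulative distribution function on [0,1] whose density f = F' satisfies f(x) ≥ m for all x ∈ [0,1], where m > 0, and sup_{x ∈ [0,1]} |f'(x)| = M < ∞. Then for every integer n ≥ 2 with (n − 2)·m² ≥ M, the function x ↦ F(x)^{n−1} is convex on [0,1]. In particular, there exists N such that F^{n−1} is convex on [0,1] for every n ≥ N. -/
open Set

noncomputable section

/-- A function on `[0, 1]` with nonnegative derivative takes values between its endpoint values. -/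
lemma mem_Icc_of_hasDerivWithinAt_nonneg {F f : ℝ → ℝ}
    (hderiv : ∀ x ∈ Icc (0:ℝ) 1, HasDerivWithinAt F (f x) (Icc 0 1) x)
    (hf : ∀ x ∈ Icc (0:ℝ) 1, 0 ≤ f x) {x : ℝ} (hx : x ∈ Icc (0:ℝ) 1) :
    F x ∈ Icc (F 0) (F 1) := by
  have hmono : MonotoneOn F (Icc 0 1) :=
    monotoneOn_of_hasDerivWithinAt_nonneg (convex_Icc 0 1)
      (fun y hy => (hderiv y hy).continuousWithinAt)
      (fun y hy => (hderiv y (interior_subset hy)).mono interior_subset)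
      (fun y hy => hf y (interior_subset hy))
  exact ⟨hmono (left_mem_Icc.2 zero_le_one) hx hx.1,
    hmono hx (right_mem_Icc.2 zero_le_one) hx.2⟩

/-- The second derivative of `F ^ (k + 1)` is nonnegative once `k * f ^ 2` dominates `|f'|`. -/
lemma pow_second_deriv_nonneg {k : ℕ} {y a b m M : ℝ} (hm : 0 < m) (hy : y ∈ Icc (0:ℝ) 1)
    (ha : m ≤ a) (hb : |b| ≤ M) (hk : M ≤ k * m ^ 2) :
    0 ≤ ((k : ℝ) + 1) * (k * y ^ (k - 1) * a * a + y ^ k * b) := by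
  have hkb : |b| ≤ k * a ^ 2 := hb.trans (hk.trans (by gcongr))
  obtain ⟨hy0, hy1⟩ := hy
  refine mul_nonneg (by positivity) ?_
  cases k with
  | zero =>
    have hb0 : b = 0 := abs_nonpos_iff.1 (by simpa using hkb)
    simp [hb0]
  | succ j =>
    have hyb : -|b| ≤ y * b := by
      have : |y * b| ≤ |b| := by
        rw [abs_mul, abs_of_nonneg hy0]
        exact mul_le_of_le_one_left (abs_nonneg b) hy1
      exact (neg_le_neg this).trans (neg_abs_le _)
    have h : 0 ≤ y ^ j * (((j + 1 : ℕ) : ℝ) * a ^ 2 + y * b) :=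
      mul_nonneg (by positivity) (by linarith)
    rw [Nat.add_sub_cancel]
    linear_combination h

/-- If F is a C² c.d.f. on [0,1] whose density f satisfies f ≥ m > 0 and
whose derivative f' is bounded by M in absolute value, then for every n ≥ 2 with
(n−2)·m² ≥ M, the function x ↦ F(x)^{n−1} is convex on [0,1]; in particular F^{n−1} is
convex for all sufficiently large n. -/
theorem cdf_power_eventually_convex
    (F f f' : ℝ → ℝ) (m M : ℝ) (hm : 0 < m)
    (hF0 : F 0 = 0) (hF1 : F 1 = 1)
    (hsmooth : ContDiffOn ℝ 2 F (Icc 0 1))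
    (hderiv : ∀ x ∈ Icc (0:ℝ) 1, HasDerivWithinAt F (f x) (Icc 0 1) x)
    (hderiv' : ∀ x ∈ Icc (0:ℝ) 1, HasDerivWithinAt f (f' x) (Icc 0 1) x)
    (hfm : ∀ x ∈ Icc (0:ℝ) 1, m ≤ f x)
    (hfM : ∀ x ∈ Icc (0:ℝ) 1, |f' x| ≤ M) :
    (∀ n : ℕ, 2 ≤ n → M ≤ ((n : ℝ) - 2) * m ^ 2 →
      ConvexOn ℝ (Icc (0:ℝ) 1) (fun x => F x ^ (n - 1))) ∧
    ∃ N : ℕ, ∀ n : ℕ, N ≤ n →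
      ConvexOn ℝ (Icc (0:ℝ) 1) (fun x => F x ^ (n - 1)) := by
  have main : ∀ n : ℕ, 2 ≤ n → M ≤ ((n : ℝ) - 2) * m ^ 2 →
      ConvexOn ℝ (Icc (0:ℝ) 1) (fun x => F x ^ (n - 1)) := by
    intro n hn hM
    obtain ⟨k, rfl⟩ := Nat.exists_eq_add_of_le' hn
    have hk : M ≤ k * m ^ 2 := by simpa using hM
    have hF : ∀ x ∈ Icc (0:ℝ) 1, F x ∈ Icc (0:ℝ) 1 := fun x hx => by
      simpa only [hF0, hF1] using
        mem_Icc_of_hasDerivWithinAt_nonneg hderiv (fun y hy => hm.le.trans (hfm y hy)) hx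
    have hd : ∀ x ∈ Icc (0:ℝ) 1, HasDerivWithinAt (fun x => F x ^ (k + 1))
        (((k : ℝ) + 1) * (F x ^ k * f x)) (Icc 0 1) x := fun x hx => by
      refine ((hderiv x hx).fun_pow (k + 1)).congr_deriv ?_
      rw [Nat.add_sub_cancel, Nat.cast_succ, mul_assoc]
    have hd' : ∀ x ∈ Icc (0:ℝ) 1,
        HasDerivWithinAt (fun x => ((k : ℝ) + 1) * (F x ^ k * f x))
          (((k : ℝ) + 1) * (k * F x ^ (k - 1) * f x * f x + F x ^ k * f' x)) (Icc 0 1) x :=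
      fun x hx => (((hderiv x hx).fun_pow k).fun_mul (hderiv' x hx)).const_mul _
    exact convexOn_of_hasDerivWithinAt2_nonneg (convex_Icc 0 1)
      (fun x hx => (hd x hx).continuousWithinAt)
      (fun x hx => (hd x (interior_subset hx)).mono interior_subset)
      (fun x hx => (hd' x (interior_subset hx)).mono interior_subset)
      (fun x hx => have hx := interior_subset hx
        pow_second_deriv_nonneg hm (hF x hx) (hfm x hx) (hfM x hx) hk)
  refine ⟨main, ?_⟩
  obtain ⟨K, hK⟩ := exists_nat_ge (M / m ^ 2)
  refine ⟨K + 2, fun n hn => main n (by omega) ?_⟩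
  have hn' : (K : ℝ) + 2 ≤ n := by exact_mod_cast hn
  rw [← div_le_iff₀ (by positivity)]
  linarith
end
end

section
/- Fix n ≥ 2 and a ∈ (0,1) with c_F(a) > c̄ (note c_F(a) = (1 − F(a))·(k_a − a)). Let r̲ ∈ (a, k_a) be defined by (1 − F(a))·(k_a − r̲) = c̄, and define D_a : [0,1] → ℝ by D_a(x) = F(x)^{n−1} on [0, a), D_a(x) = F(a)^{n−1} on [a, r̲), D_a(x) = F(a)^{n−1} + J_F(a)·(1 − H((1 − F(a))·(k_a − x))) on [r̲, k_a), and D_a(x) = F(a)^{n−1} + J_F(a) on [k_a, 1]; define φ_a(x) := D_a(x) for x ∈ [0, a] and φ_a(x) := F(a)^{n−1} + J_F(a)·(x − a)/(k_a − a) for x ∈ (a, 1]. Then φ_a(x) ≥ D_a(x) for all x ∈ [0,1] if and only if H(c)/c ≥ 1/c_F(a) for all c ∈ (0, c̄]. -/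
open MeasureTheory Set Function Filter

noncomputable section

namespace CompSearch

/-- k_a, the conditional mean E[v | v ≥ a]. -/
def kpt (F f : ℝ → ℝ) (a : ℝ) : ℝ := (∫ t in a..(1:ℝ), t * f t) / (1 - F a)

/-- J_F(a) = (1 − F(a)ⁿ)/(n(1 − F(a))) − F(a)ⁿ⁻¹. -/
def JF (F : ℝ → ℝ) (n : ℕ) (a : ℝ) : ℝ :=
  (1 - F a ^ n) / ((n : ℝ) * (1 - F a)) - F a ^ (n - 1)

/-- The interim demand D_a(x) under the upper-censorship distribution U_a. -/
def Dexp (F H : ℝ → ℝ) (n : ℕ) (a rlow ka jf : ℝ) (x : ℝ) : ℝ :=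
  if x < a then F x ^ (n - 1)
  else if x < rlow then F a ^ (n - 1)
  else if x < ka then F a ^ (n - 1) + jf * (1 - H ((1 - F a) * (ka - x)))
  else F a ^ (n - 1) + jf

/-- The virtual interim demand φ_a(x). -/
def phiExp (F H : ℝ → ℝ) (n : ℕ) (a rlow ka jf : ℝ) (x : ℝ) : ℝ :=
  if x ≤ a then Dexp F H n a rlow ka jf x
  else F a ^ (n - 1) + jf * (x - a) / (ka - a)

theorem IsPrior.strictMonoOn {F f : ℝ → ℝ} (hF : IsPrior F f) : StrictMonoOn F (Icc 0 1) := by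
  refine strictMonoOn_of_deriv_pos (convex_Icc 0 1) hF.continuousOn fun x hx => ?_
  rw [interior_Icc] at hx
  have hx' := Ioo_subset_Icc_self hx
  rw [((hF.deriv x hx').hasDerivAt (Icc_mem_nhds hx.1 hx.2)).deriv]
  exact hF.fpos x hx'

theorem IsPrior.cInt_le {F f : ℝ → ℝ} (hF : IsPrior F f) {a : ℝ} (ha : a ∈ Icc (0:ℝ) 1) :
    cInt F a ≤ (1 - F a) * (1 - a) := by
  have hsub : Icc a 1 ⊆ Icc (0:ℝ) 1 := Icc_subset_Icc_left ha.1
  have hint : IntervalIntegrable (fun t => 1 - F t) volume a 1 := by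
    apply ContinuousOn.intervalIntegrable
    rw [uIcc_of_le ha.2]
    exact continuousOn_const.sub (hF.continuousOn.mono hsub)
  have hle := intervalIntegral.integral_mono_on ha.2 hint
    (intervalIntegrable_const (c := 1 - F a))
    fun t ht => sub_le_sub_left (hF.strictMonoOn.monotoneOn ha (hsub ht) ht.1) 1
  rw [intervalIntegral.integral_const, smul_eq_mul, mul_comm] at hle
  exact hle

theorem mul_pow_mul_one_sub_lt_one_sub_pow {q : ℝ} (h0 : 0 ≤ q) (h1 : q < 1) (m : ℕ) :
    ((m : ℝ) + 2) * q ^ (m + 1) * (1 - q) < 1 - q ^ (m + 2) := by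
  induction m with
  | zero => norm_num; nlinarith [mul_pos (sub_pos.2 h1) (sub_pos.2 h1)]
  | succ m ih =>
    have hp : q ^ (m + 2) < 1 := pow_lt_one₀ h0 h1 (by omega)
    have hs := mul_pos (sub_pos.2 hp) (sub_pos.2 h1)
    have hq := mul_le_mul_of_nonneg_left ih.le h0
    push_cast
    ring_nf at hs hq ⊢
    linarith

theorem JF_pos {F : ℝ → ℝ} {a : ℝ} (h0 : 0 ≤ F a) (h1 : F a < 1) {n : ℕ} (hn : 2 ≤ n) :
    0 < JF F n a := by
  obtain ⟨m, rfl⟩ := Nat.exists_eq_add_of_le' hn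
  have hlt := mul_pow_mul_one_sub_lt_one_sub_pow h0 h1 m
  have hq : 0 < 1 - F a := sub_pos.2 h1
  rw [JF, sub_pos, lt_div_iff₀ (by positivity)]
  push_cast
  linarith

/-- On the region where the interim demand is strictly increasing, the linear interpolation
dominates it at `x` exactly when the average-density bound holds at the corresponding cost. -/
theorem demand_le_linear_iff {q k a x b j y : ℝ} (hq : 0 < q) (hak : a < k) (hxk : x < k)
    (hj : 0 < j) :
    b + j * (1 - y) ≤ b + j * (x - a) / (k - a) ↔ 1 / (q * (k - a)) ≤ y / (q * (k - x)) := by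
  have hka : 0 < k - a := sub_pos.2 hak
  have hkx : 0 < k - x := sub_pos.2 hxk
  rw [add_le_add_iff_left, mul_div_assoc, mul_le_mul_iff_right₀ hj, le_div_iff₀ hka,
    div_le_div_iff₀ (by positivity) (by positivity),
    show y * (q * (k - a)) = q * (y * (k - a)) by ring, one_mul, mul_le_mul_iff_right₀ hq]
  constructor <;> intro h <;> linarith

/-- With c_F(a) > c̄ and r̲ defined by (1 − F(a))·(k_a − r̲) = c̄, the virtual
interim demand φ_a dominates the interim demand D_a on [0,1] if and only if
H(c)/c ≥ 1/c_F(a) for all c ∈ (0,c̄]. -/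
theorem phi_dominates_iff_average_density_bound
    (F f H h : ℝ → ℝ) (cbar : ℝ)
    (hF : IsPrior F f) (hH : IsCostD H h cbar)
    (hHext : ∀ t : ℝ, cbar < t → H t = 1)
    (hcbar : cbar < mean F)
    (n : ℕ) (hn : 2 ≤ n)
    (a : ℝ) (ha : a ∈ Ioo (0:ℝ) 1) (hca : cbar < cInt F a)
    (hnote : cInt F a = (1 - F a) * (kpt F f a - a))
    (rlow : ℝ) (hrlow : (1 - F a) * (kpt F f a - rlow) = cbar)
    (hrlow_mem : rlow ∈ Ioo a (kpt F f a)) :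
    (∀ x ∈ Icc (0:ℝ) 1,
        Dexp F H n a rlow (kpt F f a) (JF F n a) x ≤
          phiExp F H n a rlow (kpt F f a) (JF F n a) x) ↔
      ∀ c ∈ Ioc (0:ℝ) cbar, 1 / cInt F a ≤ H c / c := by
  have haI : a ∈ Icc (0:ℝ) 1 := Ioo_subset_Icc_self ha
  have h0 : 0 ≤ F a := by
    rw [← hF.zero 0 le_rfl]
    exact hF.strictMonoOn.monotoneOn (left_mem_Icc.2 zero_le_one) haI ha.1.le
  have h1 : F a < 1 := by
    rw [← hF.one 1 le_rfl]
    exact hF.strictMonoOn haI (right_mem_Icc.2 zero_le_one) ha.2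
  have hq : 0 < 1 - F a := sub_pos.2 h1
  have hj : 0 < JF F n a := JF_pos h0 h1 hn
  have hk1 : kpt F f a ≤ 1 := by
    have hle := hF.cInt_le haI
    rw [hnote, mul_le_mul_iff_right₀ hq] at hle
    linarith
  rw [hnote]
  generalize kpt F f a = k at *
  generalize JF F n a = j at *
  obtain ⟨har, hrk⟩ := hrlow_mem
  have hak : a < k := har.trans hrk
  constructor
  · intro hdom c hc
    have hdiv : 0 < c / (1 - F a) := div_pos hc.1 hq
    have hr : rlow ≤ k - c / (1 - F a) := by
      have : c / (1 - F a) ≤ k - rlow := by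
        rw [div_le_iff₀ hq]
        linarith [hc.2]
      linarith
    obtain ⟨x, hx⟩ : ∃ x, x = k - c / (1 - F a) := ⟨_, rfl⟩
    rw [← hx] at hr
    have hxk : x < k := by linarith
    have hcx : c = (1 - F a) * (k - x) := by
      rw [hx]
      field_simp
      ring
    have hle := hdom x ⟨by linarith [ha.1], by linarith⟩
    rw [phiExp, if_neg (by linarith : ¬ x ≤ a), Dexp, if_neg (by linarith : ¬ x < a),
      if_neg (by linarith : ¬ x < rlow), if_pos hxk] at hle
    rw [hcx]
    exact (demand_le_linear_iff hq hak hxk hj).1 hle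
  · intro hbound x _
    rw [phiExp]
    split_ifs with hxa
    · exact le_rfl
    · rw [not_le] at hxa
      have hka : 0 < k - a := sub_pos.2 hak
      rw [Dexp, if_neg hxa.le.not_gt]
      split_ifs with hxr hxk
      · have : 0 < x - a := sub_pos.2 hxa
        exact le_add_of_nonneg_right (by positivity)
      · rw [not_lt] at hxr
        refine (demand_le_linear_iff hq hak hxk hj).2 (hbound _ ⟨mul_pos hq (sub_pos.2 hxk), ?_⟩)
        rw [← hrlow]
        exact mul_le_mul_of_nonneg_left (by linarith) hq.le
      · rw [add_le_add_iff_left, le_div_iff₀ hka]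
        exact mul_le_mul_of_nonneg_left (by linarith) hj.le

end CompSearch
end
end

section
/- Define m(H) := {c ∈ [0, c̄] : S'(c) = 0 and S(c') ≥ S(c) for all c' ∈ [0, c]}, and, when m(H) ≠ ∅ and m(H) ≠ {c̄}, let c_loc := max{c ∈ m(H) : S(c) = min_{c' ∈ m(H)} S(c')}. Assume m(H) ≠ ∅, m(H) ≠ {c̄}, and c_loc < c̄. If S(c_loc) > 1/c̄, let c_sol denote the unique solution in (c_loc, c̄) of S(c) = S(c_loc); then S'(c_sol) < 0, S'(c) < 0 for every c ∈ (c_sol, c̄], and S(c) ≥ S(c_sol) for every c ∈ [0, c_sol]. If instead S(c_loc) ≤ 1/c̄, then S(c) ≥ S(c_loc) for every c ∈ [0, c̄]. -/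
open MeasureTheory Set Function Filter

noncomputable section

namespace CompSearch

/-- m(H): critical points of S that are global minima of S on [0, ·]. -/
def mSet (H h Sd : ℝ → ℝ) (cbar : ℝ) : Set ℝ :=
  {c | c ∈ Icc (0:ℝ) cbar ∧ Sd c = 0 ∧ ∀ c' ∈ Icc (0:ℝ) c, Sfun H h c ≤ Sfun H h c'}

/-- A function that is minimal over `[a, x]` at its right end `x` has nonpositive
derivative there. -/
lemma deriv_nonpos_of_min_left {f : ℝ → ℝ} {s : Set ℝ} {a x d : ℝ} (hax : a < x)
    (hs : Icc a x ⊆ s) (hf : HasDerivWithinAt f d s x) (hmin : ∀ y ∈ Icc a x, f x ≤ f y) :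
    d ≤ 0 := by
  have h := (hasDerivWithinAt_iff_tendsto_slope' (by simp)).1
    (hf.mono (Ioo_subset_Icc_self.trans hs))
  have : NeBot (nhdsWithin x (Ioo a x)) := right_nhdsWithin_Ioo_neBot hax
  refine le_of_tendsto h (eventually_nhdsWithin_of_forall fun y hy => ?_)
  rw [slope_def_field]
  exact div_nonpos_of_nonneg_of_nonpos (sub_nonneg.2 (hmin y (Ioo_subset_Icc_self hy)))
    (sub_nonpos.2 hy.2.le)

/-- A function that is minimal over `[x, b]` at its left end `x` has nonnegative derivative
there. -/
lemma deriv_nonneg_of_min_right {f : ℝ → ℝ} {s : Set ℝ} {b x d : ℝ} (hxb : x < b)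
    (hs : Icc x b ⊆ s) (hf : HasDerivWithinAt f d s x) (hmin : ∀ y ∈ Icc x b, f x ≤ f y) :
    0 ≤ d := by
  have h := (hasDerivWithinAt_iff_tendsto_slope' (by simp)).1
    (hf.mono (Ioo_subset_Icc_self.trans hs))
  have : NeBot (nhdsWithin x (Ioo x b)) := left_nhdsWithin_Ioo_neBot hxb
  refine ge_of_tendsto h (eventually_nhdsWithin_of_forall fun y hy => ?_)
  rw [slope_def_field]
  exact div_nonneg (sub_nonneg.2 (hmin y (Ioo_subset_Icc_self hy))) (sub_nonneg.2 hy.1.le)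

/-- If `S` falls below its minimal value over `m(H)` somewhere on `[0, b]`, then its minimum over
`[0, b]` is at `b`, where its derivative is negative. -/
lemma isMin_right_of_lt {H h Sd : ℝ → ℝ} {cbar cloc b x : ℝ}
    (hSd : ∀ c ∈ Icc (0:ℝ) cbar, HasDerivWithinAt (Sfun H h) (Sd c) (Icc 0 cbar) c)
    (hmem : cloc ∈ mSet H h Sd cbar)
    (hmin : ∀ c ∈ mSet H h Sd cbar, Sfun H h cloc ≤ Sfun H h c)
    (hb : b ≤ cbar) (hx : x ∈ Icc 0 b) (hlt : Sfun H h x < Sfun H h cloc) :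
    (∀ c ∈ Icc 0 b, Sfun H h b ≤ Sfun H h c) ∧ Sd b < 0 := by
  have hcont : ContinuousOn (Sfun H h) (Icc 0 b) := fun c hc =>
    (hSd c (Icc_subset_Icc_right hb hc)).continuousWithinAt.mono (Icc_subset_Icc_right hb)
  obtain ⟨z, hz, hzmin⟩ := isCompact_Icc.exists_isMinOn ⟨x, hx⟩ hcont
  replace hzmin : ∀ c ∈ Icc 0 b, Sfun H h z ≤ Sfun H h c := fun c hc => hzmin hc
  have hzlt := (hzmin x hx).trans_lt hlt
  have hzbar : z ∈ Icc 0 cbar := Icc_subset_Icc_right hb hz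
  have hlocz : cloc < z := by
    by_contra! hle
    exact hzlt.not_ge (hmem.2.2 z ⟨hz.1, hle⟩)
  have hz0 : 0 < z := hmem.1.1.trans_lt hlocz
  have hzleft : ∀ c ∈ Icc 0 z, Sfun H h z ≤ Sfun H h c := fun c hc =>
    hzmin c (Icc_subset_Icc_right hz.2 hc)
  have hnonpos : Sd z ≤ 0 :=
    deriv_nonpos_of_min_left hz0 (Icc_subset_Icc_right hzbar.2) (hSd z hzbar) hzleft
  have hne : Sd z ≠ 0 := fun h0 => hzlt.not_ge (hmin z ⟨hzbar, h0, hzleft⟩)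
  have hneg : Sd z < 0 := lt_of_le_of_ne hnonpos hne
  obtain rfl : z = b := by
    by_contra hzb
    exact hneg.not_ge (deriv_nonneg_of_min_right (lt_of_le_of_ne hz.2 hzb)
      (Icc_subset_Icc hz.1 hb) (hSd z hzbar) fun c hc => hzmin c ⟨hz.1.trans hc.1, hc.2⟩)
  exact ⟨hzmin, hneg⟩

/-- With c_loc as in Statement 16: if S(c_loc) > 1/c̄ and c_sol ∈ (c_loc, c̄)
solves S(c) = S(c_loc), then S'(c_sol) < 0, S' < 0 on (c_sol, c̄], and S ≥ S(c_sol) on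
[0, c_sol]. If instead S(c_loc) ≤ 1/c̄, then S ≥ S(c_loc) on [0, c̄]. -/
theorem crossing_solution_properties
    (H h Sd : ℝ → ℝ) (cbar : ℝ)
    (hH : IsCostD H h cbar)
    (hfin : FinitelyPiecewiseMono h cbar)
    (hSd : ∀ c ∈ Icc (0:ℝ) cbar, HasDerivWithinAt (Sfun H h) (Sd c) (Icc 0 cbar) c)
    (hne : (mSet H h Sd cbar).Nonempty)
    (hnecbar : mSet H h Sd cbar ≠ {cbar})
    (cloc : ℝ)
    (hcloc1 : cloc ∈ mSet H h Sd cbar)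
    (hcloc2 : ∀ c ∈ mSet H h Sd cbar, Sfun H h cloc ≤ Sfun H h c)
    (hcloc3 : ∀ c ∈ mSet H h Sd cbar, Sfun H h c = Sfun H h cloc → c ≤ cloc)
    (hcloc4 : cloc < cbar) :
    (1 / cbar < Sfun H h cloc →
      ∀ csol ∈ Ioo cloc cbar, Sfun H h csol = Sfun H h cloc →
        Sd csol < 0 ∧
        (∀ c ∈ Ioc csol cbar, Sd c < 0) ∧
        (∀ c ∈ Icc (0:ℝ) csol, Sfun H h csol ≤ Sfun H h c)) ∧
    (Sfun H h cloc ≤ 1 / cbar →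
      ∀ c ∈ Icc (0:ℝ) cbar, Sfun H h cloc ≤ Sfun H h c) := by
  constructor
  · intro _ csol hcsol heq
    have h0 : 0 < csol := hcloc1.1.1.trans_lt hcsol.1
    have hbar : csol ∈ Icc 0 cbar := ⟨h0.le, hcsol.2.le⟩
    have hleft : ∀ c ∈ Icc (0:ℝ) csol, Sfun H h csol ≤ Sfun H h c := by
      intro c hc
      by_contra! hlt
      exact hlt.not_ge
        ((isMin_right_of_lt hSd hcloc1 hcloc2 hcsol.2.le hc (heq ▸ hlt)).1 c hc)
    have hneg : Sd csol < 0 := lt_of_le_of_ne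
      (deriv_nonpos_of_min_left h0 (Icc_subset_Icc_right hcsol.2.le) (hSd csol hbar) hleft)
      fun hz => hcsol.1.not_ge (hcloc3 csol ⟨hbar, hz, hleft⟩ heq)
    refine ⟨hneg, fun c hc => ?_, hleft⟩
    obtain ⟨x, hx, hlt⟩ : ∃ x ∈ Icc csol c, Sfun H h x < Sfun H h csol := by
      by_contra! hge
      exact hneg.not_ge
        (deriv_nonneg_of_min_right hc.1 (Icc_subset_Icc h0.le hc.2) (hSd csol hbar) hge)
    exact (isMin_right_of_lt hSd hcloc1 hcloc2 hc.2 ⟨h0.le.trans hx.1, hx.2⟩ (heq ▸ hlt)).2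
  · intro hle c hc
    by_contra! hlt
    have hmin := (isMin_right_of_lt hSd hcloc1 hcloc2 le_rfl hc hlt).1 c hc
    have hval : Sfun H h cbar = 1 / cbar := by
      rw [Sfun, if_neg hH.cbar_pos.ne', hH.one]
    linarith

end CompSearch
end
end
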